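/- Let ε ≥ 0 and suppose the six Hermitian involutions satisfy the nine commutation relations and the unit vector Ψ satisfies the ideal expectations within error ε: re⟪Ψ, A₁₂(A₃₄(A₅₆ Ψ))⟫ ≥ 1−ε, re⟪Ψ, A₄₅(A₁₆(A₂₃ Ψ))⟫ ≥ 1−ε, re⟪Ψ, A₁₂(A₄₅ Ψ)⟫ ≥ 1−ε, re⟪Ψ, A₃₄(A₁₆ Ψ)⟫ ≥ 1−ε, −re⟪Ψ, A₅₆(A₂₃ Ψ)⟫ ≥ 1−ε. Then ‖A₁₂(A₃₄ Ψ) + A₁₆(A₄₅ Ψ)‖ ≤ 3·√(2ε). -/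

import Mathlib

open scoped InnerProductSpace

theorem IsSelfAdjoint.norm_apply_of_comp_self_eq_one
    {H : Type*} [NormedAddCommGroup H] [InnerProductSpace ℂ H] [CompleteSpace H]
    {A : H →L[ℂ] H} (hA : IsSelfAdjoint A) (hAA : A ∘L A = 1) (x : H) : ‖A x‖ = ‖x‖ := by
  have hinner : ⟪A x, A x⟫_ℂ = ⟪x, x⟫_ℂ := by
    rw [show ⟪A x, A x⟫_ℂ = ⟪x, A (A x)⟫_ℂ from hA.isSymmetric x (A x)]
    exact congrArg (inner ℂ x) (DFunLike.congr_fun hAA x)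
  rw [@norm_eq_sqrt_re_inner ℂ, @norm_eq_sqrt_re_inner ℂ _ _ _ _ x, hinner]

theorem norm_sub_le_sqrt_of_one_sub_le_re_inner
    {H : Type*} [NormedAddCommGroup H] [InnerProductSpace ℂ H] {x y : H} {ε : ℝ}
    (hx : ‖x‖ = 1) (hy : ‖y‖ = 1) (h : 1 - ε ≤ RCLike.re ⟪x, y⟫_ℂ) :
    ‖x - y‖ ≤ Real.sqrt (2 * ε) := by
  apply Real.le_sqrt_of_sq_le
  rw [@norm_sub_sq ℂ, hx, hy]
  linarith

/-- **Lemma 6 (degree-4 norm bound).** If the unit state `Ψ` satisfies the ideal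
expectations within error `ε`, then `‖A₁₂ (A₃₄ Ψ) + A₁₆ (A₄₅ Ψ)‖ ≤ 3 √(2 ε)`. -/

theorem deg4_norm_bound
    {H : Type*} [NormedAddCommGroup H] [InnerProductSpace ℂ H] [CompleteSpace H]
    (A₁₂ A₃₄ A₅₆ A₄₅ A₁₆ A₂₃ : H →L[ℂ] H)
    (h₁₂ : IsSelfAdjoint A₁₂) (h₃₄ : IsSelfAdjoint A₃₄) (h₅₆ : IsSelfAdjoint A₅₆)
    (h₄₅ : IsSelfAdjoint A₄₅) (h₁₆ : IsSelfAdjoint A₁₆) (h₂₃ : IsSelfAdjoint A₂₃)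
    (hi₁₂ : A₁₂ ∘L A₁₂ = 1) (hi₃₄ : A₃₄ ∘L A₃₄ = 1) (hi₅₆ : A₅₆ ∘L A₅₆ = 1)
    (hi₄₅ : A₄₅ ∘L A₄₅ = 1) (hi₁₆ : A₁₆ ∘L A₁₆ = 1) (hi₂₃ : A₂₃ ∘L A₂₃ = 1)
    (c₁ : A₁₂ ∘L A₃₄ = A₃₄ ∘L A₁₂) (c₂ : A₁₂ ∘L A₅₆ = A₅₆ ∘L A₁₂)
    (c₃ : A₃₄ ∘L A₅₆ = A₅₆ ∘L A₃₄) (c₄ : A₄₅ ∘L A₁₆ = A₁₆ ∘L A₄₅)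
    (c₅ : A₄₅ ∘L A₂₃ = A₂₃ ∘L A₄₅) (c₆ : A₁₆ ∘L A₂₃ = A₂₃ ∘L A₁₆)
    (c₇ : A₁₂ ∘L A₄₅ = A₄₅ ∘L A₁₂) (c₈ : A₃₄ ∘L A₁₆ = A₁₆ ∘L A₃₄)
    (c₉ : A₅₆ ∘L A₂₃ = A₂₃ ∘L A₅₆)
    (Ψ : H) (hΨ : ‖Ψ‖ = 1) (ε : ℝ) (hε : 0 ≤ ε)
    -- ideal expectations within error ε
    (e₁ : 1 - ε ≤ RCLike.re ⟪Ψ, A₁₂ (A₃₄ (A₅₆ Ψ))⟫_ℂ)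
    (e₂ : 1 - ε ≤ RCLike.re ⟪Ψ, A₄₅ (A₁₆ (A₂₃ Ψ))⟫_ℂ)
    (e₃ : 1 - ε ≤ RCLike.re ⟪Ψ, A₁₂ (A₄₅ Ψ)⟫_ℂ)
    (e₄ : 1 - ε ≤ RCLike.re ⟪Ψ, A₃₄ (A₁₆ Ψ)⟫_ℂ)
    (e₅ : 1 - ε ≤ -RCLike.re ⟪Ψ, A₅₆ (A₂₃ Ψ)⟫_ℂ) :
    ‖A₁₂ (A₃₄ Ψ) + A₁₆ (A₄₅ Ψ)‖ ≤ 3 * Real.sqrt (2 * ε) := by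
  have n₁₂ := h₁₂.norm_apply_of_comp_self_eq_one hi₁₂
  have n₃₄ := h₃₄.norm_apply_of_comp_self_eq_one hi₃₄
  have n₅₆ := h₅₆.norm_apply_of_comp_self_eq_one hi₅₆
  have n₄₅ := h₄₅.norm_apply_of_comp_self_eq_one hi₄₅
  have n₁₆ := h₁₆.norm_apply_of_comp_self_eq_one hi₁₆
  have n₂₃ := h₂₃.norm_apply_of_comp_self_eq_one hi₂₃
  have hrow₁ : ⟪Ψ, A₁₂ (A₃₄ (A₅₆ Ψ))⟫_ℂ = ⟪A₁₂ (A₃₄ Ψ), A₅₆ Ψ⟫_ℂ := by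
    rw [show A₁₂ (A₃₄ Ψ) = A₃₄ (A₁₂ Ψ) from DFunLike.congr_fun c₁ Ψ]
    exact ((h₃₄.isSymmetric _ _).trans (h₁₂.isSymmetric _ _)).symm
  have hrow₂ : ⟪Ψ, A₄₅ (A₁₆ (A₂₃ Ψ))⟫_ℂ = ⟪A₁₆ (A₄₅ Ψ), A₂₃ Ψ⟫_ℂ :=
    ((h₁₆.isSymmetric _ _).trans (h₄₅.isSymmetric _ _)).symm
  have hcol : ⟪Ψ, A₅₆ (A₂₃ Ψ)⟫_ℂ = ⟪A₅₆ Ψ, A₂₃ Ψ⟫_ℂ := (h₅₆.isSymmetric _ _).symm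
  have b₁ : ‖A₁₂ (A₃₄ Ψ) - A₅₆ Ψ‖ ≤ Real.sqrt (2 * ε) :=
    norm_sub_le_sqrt_of_one_sub_le_re_inner (by rw [n₁₂, n₃₄, hΨ]) (by rw [n₅₆, hΨ])
      (hrow₁ ▸ e₁)
  have b₂ : ‖A₁₆ (A₄₅ Ψ) - A₂₃ Ψ‖ ≤ Real.sqrt (2 * ε) :=
    norm_sub_le_sqrt_of_one_sub_le_re_inner (by rw [n₁₆, n₄₅, hΨ]) (by rw [n₂₃, hΨ])
      (hrow₂ ▸ e₂)
  have b₃ : ‖A₅₆ Ψ - -A₂₃ Ψ‖ ≤ Real.sqrt (2 * ε) :=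
    norm_sub_le_sqrt_of_one_sub_le_re_inner (by rw [n₅₆, hΨ]) (by rw [norm_neg, n₂₃, hΨ])
      (by rw [inner_neg_right, map_neg, ← hcol]; exact e₅)
  calc ‖A₁₂ (A₃₄ Ψ) + A₁₆ (A₄₅ Ψ)‖
      = ‖(A₁₂ (A₃₄ Ψ) - A₅₆ Ψ) + (A₁₆ (A₄₅ Ψ) - A₂₃ Ψ) + (A₅₆ Ψ - -A₂₃ Ψ)‖ := by
        congr 1; abel
    _ ≤ ‖A₁₂ (A₃₄ Ψ) - A₅₆ Ψ‖ + ‖A₁₆ (A₄₅ Ψ) - A₂₃ Ψ‖ + ‖A₅₆ Ψ - -A₂₃ Ψ‖ := norm_add₃_le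
    _ ≤ 3 * Real.sqrt (2 * ε) := by linarith
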